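/- Let a and d be positive integers with a dividing 2d, and set q = 2d/a. Let G : ℂ \ {0} → M₂(ℝ) be a C^∞ function taking symmetric matrix values and satisfying the equivariance G(e^{iaθ}z) = R(dθ)·G(z)·R(dθ)ᵀ for all θ ∈ ℝ and z ∈ ℂ \ {0}. Then G extends to a C^∞ function on all of ℂ if and only if there exist C^∞ functions φ₁, φ₂, φ₃ : ℝ → ℝ such that for all real t > 0: G(t)₁₁ = φ₁(t²) + t^q·φ₂(t²), G(t)₂₂ = φ₁(t²) − t^q·φ₂(t²), and G(t)₁₂ = t^q·φ₃(t²). -/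

import Mathlib

open Matrix

/-- The 2×2 rotation matrix `R(θ)`. -/
noncomputable def rotMat (θ : ℝ) : Matrix (Fin 2) (Fin 2) ℝ :=
  !![Real.cos θ, -Real.sin θ; Real.sin θ, Real.cos θ]

lemma smooth_of_chain {E : Type*} [NormedAddCommGroup E] [NormedSpace ℝ E]
    (F : ℕ → ℝ → E) (h : ∀ n x, HasDerivAt (F n) (F (n+1) x) x) :
    ContDiff ℝ (⊤ : ℕ∞) (F 0) := by
  have key : ∀ n, iteratedDeriv n (F 0) = F n := by
    intro n
    induction n with
    | zero => simp
    | succ n ih => rw [iteratedDeriv_succ, ih]; funext x; exact (h n x).deriv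
  apply contDiff_of_differentiable_iteratedDeriv
  intro m _
  rw [key]
  exact fun x => (h m x).differentiableAt

lemma hasDerivAt_iteratedDeriv_of_smooth {E : Type*} [NormedAddCommGroup E] [NormedSpace ℝ E]
    {f : ℝ → E} (hf : ContDiff ℝ (⊤ : ℕ∞) f) (n : ℕ) (x : ℝ) :
    HasDerivAt (iteratedDeriv n f) (iteratedDeriv (n+1) f x) x := by
  rw [iteratedDeriv_succ]
  apply DifferentiableAt.hasDerivAt
  exact (hf.differentiable_iteratedDeriv n (by exact_mod_cast WithTop.coe_lt_top n)) x

lemma continuous_iteratedDeriv_of_smooth {E : Type*} [NormedAddCommGroup E] [NormedSpace ℝ E]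
    {f : ℝ → E} (hf : ContDiff ℝ (⊤ : ℕ∞) f) (n : ℕ) : Continuous (iteratedDeriv n f) :=
  continuous_iff_continuousAt.2 fun x => (hasDerivAt_iteratedDeriv_of_smooth hf n x).continuousAt

lemma hasDerivAt_scaled_integral {E : Type*} [NormedAddCommGroup E] [NormedSpace ℝ E]
    [CompleteSpace E] (k : ℕ) (g g' : ℝ → E) (hg : ∀ x, HasDerivAt g (g' x) x)
    (hg' : Continuous g') (x : ℝ) :
    HasDerivAt (fun t => ∫ s in (0:ℝ)..1, s ^ k • g (s * t))
      (∫ s in (0:ℝ)..1, s ^ (k+1) • g' (s * x)) x := by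
  have hgc : Continuous g := continuous_iff_continuousAt.2 fun x => (hg x).continuousAt
  obtain ⟨C, hC⟩ := (isCompact_Icc (a := -(|x|+1)) (b := |x|+1)).exists_bound_of_continuousOn
    hg'.continuousOn
  refine (intervalIntegral.hasDerivAt_integral_of_dominated_loc_of_deriv_le
    (F := fun t s => s ^ k • g (s * t)) (F' := fun t s => s ^ (k+1) • g' (s * t))
    (s := Metric.ball x 1) (bound := fun _ => C) (Metric.ball_mem_nhds x one_pos) ?_ ?_ ?_ ?_ ?_ ?_).2
  · refine Filter.Eventually.of_forall fun t => Continuous.aestronglyMeasurable ?_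
    fun_prop
  · apply Continuous.intervalIntegrable
    fun_prop
  · apply Continuous.aestronglyMeasurable
    fun_prop
  · refine Filter.Eventually.of_forall fun s hs t ht => ?_
    rw [Set.uIoc_of_le zero_le_one] at hs
    have ht' : |t| ≤ |x| + 1 := by
      rw [Metric.mem_ball, Real.dist_eq] at ht
      have := abs_sub_abs_le_abs_sub t x
      linarith
    have h1 : |s * t| ≤ |x| + 1 := by
      rw [abs_mul, abs_of_pos hs.1]
      nlinarith [abs_nonneg t, hs.2, hs.1]
    have h2 := hC (s * t) (abs_le.1 h1)
    rw [norm_smul, norm_pow, Real.norm_eq_abs, abs_of_pos hs.1]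
    have h3 : s ^ (k+1) ≤ 1 := pow_le_one₀ hs.1.le hs.2
    calc s ^ (k+1) * ‖g' (s*t)‖ ≤ 1 * ‖g' (s*t)‖ := by gcongr
      _ ≤ C := by simpa using h2
  · simp
  · refine Filter.Eventually.of_forall fun s hs t ht => ?_
    have h1 : HasDerivAt (fun t => s * t) s t := by simpa using (hasDerivAt_id t).const_mul s
    have h2 := ((hg (s*t)).scomp t h1).const_smul (s^k)
    rw [smul_smul, ← pow_succ] at h2
    exact h2

lemma smooth_scaled_integral {E : Type*} [NormedAddCommGroup E] [NormedSpace ℝ E]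
    [CompleteSpace E] (k : ℕ) (g : ℝ → E) (hg : ContDiff ℝ (⊤ : ℕ∞) g) :
    ContDiff ℝ (⊤ : ℕ∞) (fun t : ℝ => ∫ s in (0:ℝ)..1, s ^ k • g (s * t)) := by
  have := smooth_of_chain
    (fun n t => ∫ s in (0:ℝ)..1, s ^ (k+n) • iteratedDeriv n g (s * t))
    (fun n x => hasDerivAt_scaled_integral (k+n) _ _ (hasDerivAt_iteratedDeriv_of_smooth hg n)
      (continuous_iteratedDeriv_of_smooth hg (n+1)) x)
  simpa using this

/-- Hadamard-type division. -/
lemma hadamard_div {E : Type*} [NormedAddCommGroup E] [NormedSpace ℝ E]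
    [CompleteSpace E] (k : ℕ) (f g : ℝ → E) (hg : ContDiff ℝ (⊤ : ℕ∞) g)
    (hf : ∀ t, HasDerivAt f (t ^ k • g t) t) (h0 : f 0 = 0) :
    ∃ h : ℝ → E, ContDiff ℝ (⊤ : ℕ∞) h ∧ ∀ t, f t = t ^ (k+1) • h t := by
  refine ⟨_, smooth_scaled_integral k g hg, fun t => ?_⟩
  have hgc := hg.continuous
  have h1 : ∀ s ∈ Set.uIcc (0:ℝ) 1, HasDerivAt (fun s => f (s * t))
      (t ^ (k+1) • (s ^ k • g (s * t))) s := by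
    intro s _
    have h1 : HasDerivAt (fun s => s * t) t s := by simpa using (hasDerivAt_id s).mul_const t
    have h2 := (hf (s*t)).scomp s h1
    have h3 : t ^ (k+1) • (s ^ k • g (s * t)) = t • (s * t) ^ k • g (s * t) := by
      rw [smul_smul, smul_smul]; congr 1; ring
    rw [h3]; exact h2
  have h2 := intervalIntegral.integral_eq_sub_of_hasDerivAt h1
    (Continuous.intervalIntegrable (by fun_prop) _ _)
  rw [intervalIntegral.integral_smul] at h2
  simp [h0] at h2
  exact h2.symm

/-- Borel's lemma. -/
lemma borel_lemma (c : ℕ → ℝ) :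
    ∃ g : ℝ → ℝ, ContDiff ℝ (⊤ : ℕ∞) g ∧ ∀ n, iteratedDeriv n g 0 = c n := by
  let χ : ContDiffBump (0:ℝ) := ⟨1, 2, one_pos, one_lt_two⟩
  have hχ : ContDiff ℝ (⊤ : ℕ∞) (χ : ℝ → ℝ) := χ.contDiff
  let η : ℕ → ℝ → ℝ := fun n y => y ^ n * χ y
  have hη : ∀ n, ContDiff ℝ (⊤ : ℕ∞) (η n) := fun n => (contDiff_id.pow n).mul hχ
  have hηc : ∀ n, HasCompactSupport (η n) := fun n => χ.hasCompactSupport.mul_left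
  have hB : ∀ n k : ℕ, ∃ B : ℝ, 0 ≤ B ∧ ∀ x, |iteratedDeriv k (η n) x| ≤ B := by
    intro n k
    obtain ⟨B, hB⟩ := ((hη n).continuous_iteratedFDeriv
      (m := k) (by exact_mod_cast le_top)).bounded_above_of_compact_support
      ((hηc n).iteratedFDeriv k)
    refine ⟨B, (norm_nonneg _).trans (hB 0), fun x => ?_⟩
    rw [← Real.norm_eq_abs, ← norm_iteratedFDeriv_eq_norm_iteratedDeriv]
    exact hB x
  choose B hB0 hB using hB
  let b : ℕ → ℝ := fun n => c n / (n.factorial : ℝ)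
  let M : ℕ → ℝ := fun n => 1 + 2 ^ n * |b n| * ∑ k ∈ Finset.range n, B n k
  have hM1 : ∀ n, 1 ≤ M n := by
    intro n
    have : 0 ≤ ∑ k ∈ Finset.range n, B n k := Finset.sum_nonneg fun k _ => hB0 n k
    have : 0 ≤ 2 ^ n * |b n| * ∑ k ∈ Finset.range n, B n k := by positivity
    simp only [M]; linarith
  have hMB : ∀ n k, k < n → 2 ^ n * |b n| * B n k ≤ M n := by
    intro n k hk
    have h1 : B n k ≤ ∑ k ∈ Finset.range n, B n k :=
      Finset.single_le_sum (f := fun k => B n k) (fun k _ => hB0 n k) (Finset.mem_range.2 hk)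
    have h2 : 2 ^ n * |b n| * B n k ≤ 2 ^ n * |b n| * ∑ k ∈ Finset.range n, B n k := by gcongr
    simp only [M]; linarith
  let p : ℕ → ℝ → ℝ := fun n x => (b n * (M n ^ n)⁻¹) * η n (M n * x)
  have hp : ∀ n, ContDiff ℝ (⊤ : ℕ∞) (p n) := fun n =>
    contDiff_const.mul ((hη n).comp (contDiff_const.mul contDiff_id))
  have hpd : ∀ n k x, iteratedDeriv k (p n) x =
      (b n * (M n ^ n)⁻¹) * (M n ^ k * iteratedDeriv k (η n) (M n * x)) := by
    intro n k x
    have h1 : ContDiff ℝ k (η n) := (hη n).of_le (by exact_mod_cast le_top)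
    simp only [p]
    rw [iteratedDeriv_const_mul_field]
    rw [iteratedDeriv_comp_const_mul h1 (M n)]
  let v : ℕ → ℕ → ℝ := fun k n => (1/2 : ℝ) ^ n +
    (if k < n then 0 else |b n| * (M n ^ n)⁻¹ * (M n ^ k * B n k))
  have hv : ∀ k : ℕ, Summable (v k) := by
    intro k
    apply Summable.add
    · exact summable_geometric_of_lt_one (by norm_num) (by norm_num)
    · apply summable_of_hasFiniteSupport
      apply (Set.finite_le_nat k).subset
      intro n hn
      by_contra h
      simp only [Set.mem_ofPred_eq, not_le] at h
      simp [h] at hn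
  have hbound : ∀ k n x, |iteratedDeriv k (p n) x| ≤ v k n := by
    intro k n x
    have hM0 : 0 < M n := lt_of_lt_of_le one_pos (hM1 n)
    have h1 : |iteratedDeriv k (p n) x| ≤ |b n| * (M n ^ n)⁻¹ * (M n ^ k * B n k) := by
      rw [hpd, abs_mul, abs_mul, abs_mul, abs_inv, abs_pow, abs_pow, abs_of_pos hM0]
      gcongr
      exact hB n k _
    refine h1.trans ?_
    by_cases hk : k < n
    · simp only [v, if_pos hk, add_zero]
      obtain ⟨m, rfl⟩ : ∃ m, n = k + 1 + m := ⟨n - (k+1), by omega⟩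
      set n := k + 1 + m
      have h2 := hMB n k hk
      have h3 : (M n ^ n)⁻¹ * M n ^ k ≤ (M n)⁻¹ := by
        have : M n ^ n = M n ^ k * M n * M n ^ m := by
          rw [← pow_succ, ← pow_add]
        rw [this]
        have h4 : 1 ≤ M n ^ m := one_le_pow₀ (hM1 n)
        have h5 : (M n ^ k * M n * M n ^ m)⁻¹ * M n ^ k = (M n)⁻¹ * (M n ^ m)⁻¹ := by
          field_simp
        rw [h5]
        have : (M n ^ m)⁻¹ ≤ 1 := inv_le_one_of_one_le₀ h4
        have h6 : 0 < (M n)⁻¹ := inv_pos.2 hM0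
        nlinarith
      calc |b n| * (M n ^ n)⁻¹ * (M n ^ k * B n k)
          = (|b n| * B n k) * ((M n ^ n)⁻¹ * M n ^ k) := by ring
        _ ≤ (|b n| * B n k) * (M n)⁻¹ := by
          have := hB0 n k
          gcongr
        _ ≤ (1/2)^n := by
          rw [← div_eq_mul_inv, div_le_iff₀ hM0, one_div, inv_pow, inv_mul_eq_div,
            le_div_iff₀ (by positivity)]
          linarith
    · simp only [v, if_neg hk]
      have : (0:ℝ) ≤ (1/2)^n := by positivity
      linarith
  have hbound' : ∀ (k : ℕ) (n : ℕ) (x : ℝ), (k : ℕ∞) ≤ (⊤ : ℕ∞) →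
      ‖iteratedFDeriv ℝ k (p n) x‖ ≤ v k n := by
    intro k n x _
    rw [norm_iteratedFDeriv_eq_norm_iteratedDeriv]
    exact hbound k n x
  refine ⟨fun x => ∑' n, p n x, contDiff_tsum (N := (⊤ : ℕ∞)) hp (fun k _ => hv k)
    (fun k n x _ => hbound' k n x le_top), fun k => ?_⟩
  have hs : ∀ k, Summable fun n => iteratedFDeriv ℝ k (p n) (0:ℝ) := fun k =>
    Summable.of_norm_bounded (hv k) fun n => hbound' k n 0 le_top
  rw [iteratedDeriv_eq_iteratedFDeriv, iteratedFDeriv_tsum_apply (N := (⊤ : ℕ∞)) hp (fun k _ => hv k)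
    hbound' le_top, ContinuousMultilinearMap.tsum_eval (hs k)]
  simp_rw [← iteratedDeriv_eq_iteratedFDeriv]
  have hη0 : ∀ n, iteratedDeriv k (η n) 0 = if k = n then (n.factorial : ℝ) else 0 := by
    intro n
    have e := iteratedDeriv_fun_pow_zero (𝕜 := ℝ) (n := k) (m := n)
    push_cast at e
    rw [← e]
    apply Filter.EventuallyEq.iteratedDeriv_eq
    filter_upwards [χ.eventuallyEq_one] with y hy
    simp [η, hy]
  rw [tsum_eq_single k]
  · have hM0 : M k ≠ 0 := (lt_of_lt_of_le one_pos (hM1 k)).ne'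
    rw [hpd, mul_zero, hη0, if_pos rfl]
    have : (k.factorial : ℝ) ≠ 0 := by positivity
    simp only [b]
    field_simp
  · intro n hn
    rw [hpd, mul_zero, hη0, if_neg (Ne.symm hn)]
    simp

/-- Whitney's theorem on even functions. -/
lemma whitney_even (f : ℝ → ℝ) (hf : ContDiff ℝ (⊤ : ℕ∞) f) (heven : ∀ t, f (-t) = f t) :
    ∃ φ : ℝ → ℝ, ContDiff ℝ (⊤ : ℕ∞) φ ∧ ∀ t, 0 ≤ t → f t = φ (t ^ 2) := by
  let S := {f : ℝ → ℝ // ContDiff ℝ (⊤ : ℕ∞) f ∧ ∀ t, f (-t) = f t}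
  have step : ∀ f : S, ∃ h : S, ∀ t, HasDerivAt f.1 (2 * t * h.1 t) t := by
    rintro ⟨f, hf, he⟩
    have hd : ∀ t, HasDerivAt f (deriv f t) t := fun t =>
      (hf.differentiable (by simp) t).hasDerivAt
    have hd1 : ContDiff ℝ (⊤ : ℕ∞) (deriv f) := (contDiff_infty_iff_deriv.1 hf).2
    have hd2 : ContDiff ℝ (⊤ : ℕ∞) (deriv (deriv f)) := (contDiff_infty_iff_deriv.1 hd1).2
    have hodd : ∀ t, deriv f (-t) = - deriv f t := by
      intro t
      have h1 := deriv_comp_neg f t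
      rw [funext he] at h1
      linarith
    have h0 : deriv f 0 = 0 := by
      have := hodd 0
      rw [neg_zero] at this; linarith
    obtain ⟨h, hh, hh2⟩ := hadamard_div 0 (deriv f) (deriv (deriv f)) hd2
      (fun t => by simpa using (hd1.differentiable (by simp) t).hasDerivAt) h0
    refine ⟨⟨fun t => h t / 2, hh.div_const 2, fun t => ?_⟩, fun t => ?_⟩
    · rcases eq_or_ne t 0 with rfl | ht
      · simp
      · have h1 := hodd t
        rw [hh2, hh2] at h1
        simp at h1
        rcases h1 with h1 | h1
        · simp [h1]
        · exact absurd h1 ht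
    · have := hd t
      rw [hh2] at this
      convert this using 1
      simp; ring
  choose T hT using step
  let F : ℕ → S := fun n => T^[n] ⟨f, hf, heven⟩
  have hF : ∀ n t, HasDerivAt (F n).1 (2 * t * (F (n+1)).1 t) t := by
    intro n t
    have := hT (F n) t
    simpa [F, Function.iterate_succ_apply'] using this
  obtain ⟨g, hg, hgc⟩ := borel_lemma (fun n => (F n).1 0)
  let φ : ℕ → ℝ → ℝ := fun n x => if 0 ≤ x then (F n).1 (Real.sqrt x) else iteratedDeriv n g x
  have hφc : ∀ n, Continuous (φ n) := by
    intro n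
    refine Continuous.if_le ((F n).2.1.continuous.comp Real.continuous_sqrt)
      (continuous_iteratedDeriv_of_smooth hg n) continuous_const continuous_id ?_
    rintro x rfl
    simp [hgc]
  have hφd : ∀ n x, HasDerivAt (φ n) (φ (n+1) x) x := by
    intro n x
    refine hasDerivAt_of_hasDerivAt_of_ne' (x := 0) ?_ (hφc n).continuousAt
      (hφc (n+1)).continuousAt x
    intro y hy
    rcases lt_or_gt_of_ne hy with hy | hy
    · have h1 := hasDerivAt_iteratedDeriv_of_smooth hg n y
      have h2 : φ (n+1) y = iteratedDeriv (n+1) g y := by simp [φ, hy]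
      rw [h2]
      refine h1.congr_of_eventuallyEq ?_
      filter_upwards [Iio_mem_nhds hy] with z hz
      have : ¬ (0 ≤ z) := not_le.2 hz
      simp [φ, this]
    · have h1 := (hF n (Real.sqrt y)).comp y (Real.hasDerivAt_sqrt hy.ne')
      have h2 : φ (n+1) y = 2 * Real.sqrt y * (F (n+1)).1 (Real.sqrt y) * (1 / (2 * Real.sqrt y)) := by
        have : Real.sqrt y ≠ 0 := (Real.sqrt_pos.2 hy).ne'
        simp only [φ, if_pos hy.le]; field_simp
      rw [h2]
      refine h1.congr_of_eventuallyEq ?_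
      filter_upwards [Ioi_mem_nhds hy] with z hz
      have : 0 ≤ z := le_of_lt hz
      simp [φ, this]
  refine ⟨φ 0, smooth_of_chain φ hφd, fun t ht => ?_⟩
  simp [φ, sq_nonneg, Real.sqrt_sq ht, F]

lemma weight_div (k : ℕ) : ∀ q : ℕ, k ≤ q → ∀ w : ℂ → ℂ, ContDiff ℝ (⊤ : ℕ∞) w →
    (∀ u z : ℂ, ‖u‖ = 1 → w (u * z) = u ^ q * w z) →
    ∃ h : ℝ → ℂ, ContDiff ℝ (⊤ : ℕ∞) h ∧ ∀ t : ℝ, w (t : ℂ) = t ^ k • h t := by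
  induction k with
  | zero =>
    intro q _ w hw _
    exact ⟨fun t => w t, hw.comp Complex.ofRealCLM.contDiff, fun t => by simp⟩
  | succ k ih =>
    intro q hq w hw hwt
    obtain ⟨p, rfl⟩ : ∃ p, q = p + 1 := ⟨q - 1, by omega⟩
    have hdiff : ∀ z, HasFDerivAt w (fderiv ℝ w z) z := fun z =>
      (hw.differentiable (by simp) z).hasFDerivAt
    have hD : ContDiff ℝ (⊤ : ℕ∞) (fderiv ℝ w) := (contDiff_infty_iff_fderiv.1 hw).2
    have hDv : ∀ v : ℂ, ContDiff ℝ (⊤ : ℕ∞) (fun z => fderiv ℝ w z v) := fun v =>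
      hD.clm_apply contDiff_const
    -- chain rule
    have hchain : ∀ u z v : ℂ, ‖u‖ = 1 →
        fderiv ℝ w (u * z) (u * v) = u ^ (p+1) * fderiv ℝ w z v := by
      intro u z v hu
      have hl : HasFDerivAt (fun z : ℂ => u * z) (u • ContinuousLinearMap.id ℝ ℂ) z :=
        (hasFDerivAt_id z).const_mul u
      have h1 := (hdiff (u * z)).comp z hl
      have h2 := (hdiff z).const_mul (u ^ (p+1))
      have h3 : (w ∘ fun z : ℂ => u * z) = fun z => u ^ (p+1) * w z := by
        funext z; exact hwt u z hu
      rw [h3] at h1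
      have h4 := congrArg (fun L : ℂ →L[ℝ] ℂ => L v) (h1.unique h2)
      simpa using h4
    have hlin : ∀ (z : ℂ) (x y : ℝ), fderiv ℝ w z (x + y * Complex.I) =
        x * fderiv ℝ w z 1 + y * fderiv ℝ w z Complex.I := by
      intro z x y
      have : (x + y * Complex.I : ℂ) = x • (1:ℂ) + y • Complex.I := by simp
      rw [this, map_add, map_smul, map_smul]; simp
    have hrot : ∀ u z : ℂ, ‖u‖ = 1 →
        fderiv ℝ w (u * z) 1 = u ^ (p+1) *
          (u.re * fderiv ℝ w z 1 - u.im * fderiv ℝ w z Complex.I) ∧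
        fderiv ℝ w (u * z) Complex.I = u ^ (p+1) *
          (u.im * fderiv ℝ w z 1 + u.re * fderiv ℝ w z Complex.I) := by
      intro u z hu
      have huu : u * (u.re - u.im * Complex.I) = 1 := by
        have h1 : u * (starRingEnd ℂ) u = 1 := by
          rw [Complex.mul_conj, Complex.normSq_eq_norm_sq, hu]; simp
        rw [← h1]; congr 1
        apply Complex.ext <;> simp
      constructor
      · have h1 := hchain u z ((u.re : ℝ) + (-u.im : ℝ) * Complex.I) hu
        rw [hlin] at h1
        have h2 : u * ((u.re : ℝ) + (-u.im : ℝ) * Complex.I) = 1 := by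
          rw [← huu]; push_cast; ring
        rw [h2] at h1
        rw [h1]; push_cast; ring
      · have h1 := hchain u z ((u.im : ℝ) + (u.re : ℝ) * Complex.I) hu
        rw [hlin] at h1
        have h2 : u * ((u.im : ℝ) + (u.re : ℝ) * Complex.I) = Complex.I := by
          linear_combination Complex.I * huu + u * u.im * Complex.I_sq
        rw [h2] at h1
        rw [h1]
    have hw0 : w 0 = 0 := by
      have hu : ‖Complex.exp ((Real.pi / (p+1) : ℝ) * Complex.I)‖ = 1 :=
        Complex.norm_exp_ofReal_mul_I _
      have h1 := hwt _ 0 hu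
      rw [mul_zero, ← Complex.exp_nat_mul] at h1
      have h2 : ((p+1 : ℕ) : ℂ) * ((Real.pi / (p+1) : ℝ) * Complex.I) = Real.pi * Complex.I := by
        have : ((p:ℂ)+1) ≠ 0 := by exact_mod_cast Nat.succ_ne_zero p
        push_cast; field_simp
      rw [h2, Complex.exp_pi_mul_I] at h1
      have h3 : (2:ℂ) * w 0 = 0 := by linear_combination h1
      simpa using h3
    obtain ⟨hA, hAs, hA'⟩ := ih p (by omega)
      (fun z => (fderiv ℝ w z 1 - Complex.I * fderiv ℝ w z Complex.I) / 2)
      (((hDv 1).sub (contDiff_const.mul (hDv Complex.I))).div_const 2) (by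
        intro u z hu
        obtain ⟨h1, h2⟩ := hrot u z hu
        have huu : u * (u.re - u.im * Complex.I) = 1 := by
          have h1 : u * (starRingEnd ℂ) u = 1 := by
            rw [Complex.mul_conj, Complex.normSq_eq_norm_sq, hu]; simp
          rw [← h1]; congr 1
          apply Complex.ext <;> simp
        simp only [h1, h2]
        linear_combination u ^ p * (fderiv ℝ w z 1 - Complex.I * fderiv ℝ w z Complex.I) / 2 * huu
          - u ^ p * u * u.im * fderiv ℝ w z Complex.I / 2 * Complex.I_sq)
    obtain ⟨hB, hBs, hB'⟩ := ih (p + 2) (by omega)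
      (fun z => (fderiv ℝ w z 1 + Complex.I * fderiv ℝ w z Complex.I) / 2)
      (((hDv 1).add (contDiff_const.mul (hDv Complex.I))).div_const 2) (by
        intro u z hu
        obtain ⟨h1, h2⟩ := hrot u z hu
        simp only [h1, h2]
        have huu : u = u.re + u.im * Complex.I := (Complex.re_add_im u).symm
        have h3 : u ^ (p+2) = u ^ (p+1) * (u.re + u.im * Complex.I) := by
          rw [← huu]; ring
        rw [h3]
        linear_combination
          - u ^ (p+1) * u.im * fderiv ℝ w z Complex.I / 2 * Complex.I_sq)
    refine hadamard_div k (fun t : ℝ => w t) (fun t => hA t + hB t) (hAs.add hBs) (fun t => ?_)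
      (by simpa using hw0)
    have h1 := (hdiff (t : ℂ)).comp_hasDerivAt t (Complex.ofRealCLM.hasDerivAt (x := t))
    have h2 : t ^ k • (hA t + hB t) = fderiv ℝ w t 1 := by
      rw [smul_add, ← hA', ← hB']; ring
    rw [h2]
    have h3 : HasDerivAt (w ∘ Complex.ofReal) (fderiv ℝ w t 1) t := by simpa using h1
    exact h3

/-- The complex number encoding the traceless part. -/
noncomputable def tracelessPart (A : Matrix (Fin 2) (Fin 2) ℝ) : ℂ :=
  (((A 0 0 - A 1 1) / 2 : ℝ) : ℂ) + ((A 0 1 : ℝ) : ℂ) * Complex.I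

lemma rot_trace (A : Matrix (Fin 2) (Fin 2) ℝ) (φ : ℝ) :
    (rotMat φ * A * (rotMat φ)ᵀ) 0 0 + (rotMat φ * A * (rotMat φ)ᵀ) 1 1 = A 0 0 + A 1 1 := by
  simp [rotMat, Matrix.mul_apply, Matrix.vecMul, dotProduct, Fin.sum_univ_two]
  linear_combination (A 0 0 + A 1 1) * Real.sin_sq_add_cos_sq φ

lemma rot_traceless (A : Matrix (Fin 2) (Fin 2) ℝ) (hA : A.IsSymm) (φ : ℝ) :
    tracelessPart (rotMat φ * A * (rotMat φ)ᵀ) =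
      Complex.exp ((2 * φ : ℝ) * Complex.I) * tracelessPart A := by
  have h10 : A 1 0 = A 0 1 := hA.apply 0 1
  rw [Complex.exp_mul_I, ← Complex.ofReal_cos, ← Complex.ofReal_sin, Real.cos_two_mul',
    Real.sin_two_mul]
  unfold rotMat
  generalize Real.cos φ = c
  generalize Real.sin φ = s
  apply Complex.ext
  · simp [tracelessPart, Matrix.mul_apply, Matrix.vecMul, dotProduct, Fin.sum_univ_two, h10, sq]
    ring
  · simp [tracelessPart, Matrix.mul_apply, Matrix.vecMul, dotProduct, Fin.sum_univ_two, h10, sq]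
    ring

theorem smooth_extension_iff_metric_on_irreducible_module
    (a d : ℕ) (ha : 0 < a) (hd : 0 < d) (hdvd : a ∣ 2 * d)
    (G : ℂ → Matrix (Fin 2) (Fin 2) ℝ)
    (hsmooth : ∀ i j : Fin 2, ContDiffOn ℝ (⊤ : ℕ∞) (fun z => G z i j) {0}ᶜ)
    (hsymm : ∀ z : ℂ, z ≠ 0 → (G z).IsSymm)
    (hequiv : ∀ (θ : ℝ) (z : ℂ), z ≠ 0 →
      G (Complex.exp ((a * θ : ℝ) * Complex.I) * z) =
        rotMat (d * θ) * G z * (rotMat (d * θ))ᵀ) :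
    (∃ Ge : ℂ → Matrix (Fin 2) (Fin 2) ℝ,
        (∀ i j : Fin 2, ContDiff ℝ (⊤ : ℕ∞) fun z => Ge z i j) ∧
        ∀ z : ℂ, z ≠ 0 → Ge z = G z) ↔
      ∃ φ₁ φ₂ φ₃ : ℝ → ℝ,
        ContDiff ℝ (⊤ : ℕ∞) φ₁ ∧ ContDiff ℝ (⊤ : ℕ∞) φ₂ ∧
        ContDiff ℝ (⊤ : ℕ∞) φ₃ ∧
        ∀ t : ℝ, 0 < t →
          G (t : ℂ) 0 0 = φ₁ (t ^ 2) + t ^ (2 * d / a) * φ₂ (t ^ 2) ∧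
          G (t : ℂ) 1 1 = φ₁ (t ^ 2) - t ^ (2 * d / a) * φ₂ (t ^ 2) ∧
          G (t : ℂ) 0 1 = t ^ (2 * d / a) * φ₃ (t ^ 2) := by
  obtain ⟨q, hq⟩ := hdvd
  have hq' : 2 * d / a = q := by rw [hq]; exact Nat.mul_div_cancel_left q ha
  rw [hq']
  have haR : (a : ℝ) ≠ 0 := by exact_mod_cast ha.ne'
  have hqR : (2 : ℝ) * d = a * q := by exact_mod_cast hq
  -- equivariance, reparametrised
  have htr : ∀ (ψ : ℝ) (z : ℂ), z ≠ 0 →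
      G (Complex.exp (ψ * Complex.I) * z) 0 0 + G (Complex.exp (ψ * Complex.I) * z) 1 1
        = G z 0 0 + G z 1 1 := by
    intro ψ z hz
    have h := hequiv (ψ / a) z hz
    rw [mul_div_cancel₀ ψ haR] at h
    rw [h, rot_trace]
  have htl : ∀ (ψ : ℝ) (z : ℂ), z ≠ 0 →
      tracelessPart (G (Complex.exp (ψ * Complex.I) * z)) =
        Complex.exp (ψ * Complex.I) ^ q * tracelessPart (G z) := by
    intro ψ z hz
    have h := hequiv (ψ / a) z hz
    rw [mul_div_cancel₀ ψ haR] at h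
    rw [h, rot_traceless _ (hsymm z hz), ← Complex.exp_nat_mul]
    congr 2
    have : 2 * (d * (ψ / a)) = q * ψ := by
      field_simp; linear_combination ψ * hqR
    rw [this]; push_cast; ring
  constructor
  · rintro ⟨Ge, hGe, hext⟩
    -- trace part
    have hof : ContDiff ℝ (⊤ : ℕ∞) (fun t : ℝ => (t : ℂ)) := Complex.ofRealCLM.contDiff
    obtain ⟨φ₁, hφ₁, hφ₁'⟩ := whitney_even (fun t : ℝ => (Ge t 0 0 + Ge t 1 1) / 2)
      ((((hGe 0 0).comp hof).add ((hGe 1 1).comp hof)).div_const 2) (by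
        intro t
        rcases eq_or_ne t 0 with rfl | ht
        · simp
        · have ht' : (t : ℂ) ≠ 0 := by exact_mod_cast ht
          have h := htr Real.pi t ht'
          rw [Complex.exp_pi_mul_I, neg_one_mul] at h
          simp only [Complex.ofReal_neg]
          rw [hext _ ht', hext _ (neg_ne_zero.2 ht'), h])
    have hcast : ∀ f : ℂ → ℝ, ContDiff ℝ (⊤ : ℕ∞) f →
        ContDiff ℝ (⊤ : ℕ∞) (fun z => (f z : ℂ)) := fun f hf => hof.comp hf
    have hws : ContDiff ℝ (⊤ : ℕ∞) (fun z => tracelessPart (Ge z)) :=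
      (hcast _ (((hGe 0 0).sub (hGe 1 1)).div_const 2)).add
        ((hcast _ (hGe 0 1)).mul contDiff_const)
    have hww : ∀ u z : ℂ, ‖u‖ = 1 →
        tracelessPart (Ge (u * z)) = u ^ q * tracelessPart (Ge z) := by
      intro u z hu
      have hu0 : u ≠ 0 := by rintro rfl; simp at hu
      have hcont := hws.continuous
      have := Continuous.ext_on (dense_compl_singleton (0:ℂ))
        (f := fun z => tracelessPart (Ge (u * z))) (g := fun z => u ^ q * tracelessPart (Ge z))
        (hcont.comp (continuous_const.mul continuous_id)) (continuous_const.mul hcont) (by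
          intro z hz
          have hz : z ≠ 0 := hz
          have hue : Complex.exp (u.arg * Complex.I) = u := by
            have := Complex.norm_mul_exp_arg_mul_I u
            rwa [hu, Complex.ofReal_one, one_mul] at this
          have h := htl u.arg z hz
          rw [hue] at h
          simp only
          rw [hext _ hz, hext _ (mul_ne_zero hu0 hz), h])
      exact congrFun this z
    obtain ⟨h, hs, hh⟩ := weight_div q q le_rfl _ hws hww
    have heven : ∀ t, h (-t) = h t := by
      intro t
      rcases eq_or_ne t 0 with rfl | ht
      · simp
      · have h1 := hww (-1) t (by simp)
        rw [neg_one_mul, ← Complex.ofReal_neg, hh, hh, neg_pow] at h1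
        have h2 : ((-1:ℂ)) ^ q * (t:ℂ) ^ q ≠ 0 := by
          have : (t:ℂ) ≠ 0 := by exact_mod_cast ht
          exact mul_ne_zero (pow_ne_zero _ (by simp)) (pow_ne_zero _ this)
        apply mul_left_cancel₀ h2
        simpa [mul_assoc] using h1
    obtain ⟨φ₂, hφ₂, hφ₂'⟩ := whitney_even (fun t => (h t).re)
      (Complex.reCLM.contDiff.comp hs) (fun t => by simp only [heven])
    obtain ⟨φ₃, hφ₃, hφ₃'⟩ := whitney_even (fun t => (h t).im)
      (Complex.imCLM.contDiff.comp hs) (fun t => by simp only [heven])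
    refine ⟨φ₁, φ₂, φ₃, hφ₁, hφ₂, hφ₃, fun t ht => ?_⟩
    have ht' : (t : ℂ) ≠ 0 := by exact_mod_cast ht.ne'
    have e1 := hφ₁' t ht.le
    have e2 := hφ₂' t ht.le
    have e3 := hφ₃' t ht.le
    have e4 := hh t
    simp only [hext _ ht'] at e1 e4
    have e5 := congrArg Complex.re e4
    have e6 := congrArg Complex.im e4
    rw [Complex.smul_re, smul_eq_mul] at e5
    rw [Complex.smul_im, smul_eq_mul] at e6
    simp [tracelessPart] at e5 e6
    rw [← e1, ← e2, ← e3, ← e5, ← e6]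
    refine ⟨by ring, by ring, rfl⟩
  · rintro ⟨φ₁, φ₂, φ₃, hφ₁, hφ₂, hφ₃, hG⟩
    let w : ℂ → ℂ := fun z => z ^ q *
      ((φ₂ (Complex.normSq z) : ℂ) + (φ₃ (Complex.normSq z) : ℂ) * Complex.I)
    let f : ℂ → ℝ := fun z => φ₁ (Complex.normSq z)
    have hof : ContDiff ℝ (⊤ : ℕ∞) (fun t : ℝ => (t : ℂ)) := Complex.ofRealCLM.contDiff
    have hn : ContDiff ℝ (⊤ : ℕ∞) (fun z : ℂ => Complex.normSq z) := by
      simp only [Complex.normSq_apply]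
      exact (Complex.reCLM.contDiff.mul Complex.reCLM.contDiff).add
        (Complex.imCLM.contDiff.mul Complex.imCLM.contDiff)
    have hw : ContDiff ℝ (⊤ : ℕ∞) w := (contDiff_id.pow q).mul
      ((hof.comp (hφ₂.comp hn)).add ((hof.comp (hφ₃.comp hn)).mul contDiff_const))
    have hwr : ContDiff ℝ (⊤ : ℕ∞) (fun z => (w z).re) := Complex.reCLM.contDiff.comp hw
    have hwi : ContDiff ℝ (⊤ : ℕ∞) (fun z => (w z).im) := Complex.imCLM.contDiff.comp hw
    have hf : ContDiff ℝ (⊤ : ℕ∞) f := hφ₁.comp hn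
    refine ⟨fun z => !![f z + (w z).re, (w z).im; (w z).im, f z - (w z).re], ?_, ?_⟩
    · intro i j
      fin_cases i <;> fin_cases j
      · exact hf.add hwr
      · exact hwi
      · exact hwi
      · exact hf.sub hwr
    · intro z hz
      have hpos : 0 < ‖z‖ := norm_pos_iff.2 hz
      have hne : ((‖z‖ : ℝ) : ℂ) ≠ 0 := by exact_mod_cast hpos.ne'
      obtain ⟨g1, g2, g3⟩ := hG ‖z‖ hpos
      have hpolar : Complex.exp (z.arg * Complex.I) * (‖z‖ : ℂ) = z := by
        rw [mul_comm]; exact Complex.norm_mul_exp_arg_mul_I z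
      have t1 := htr z.arg ‖z‖ hne
      have t2 := htl z.arg ‖z‖ hne
      rw [hpolar] at t1 t2
      have t3 : tracelessPart (G z) = w z := by
        rw [t2]
        simp only [w, tracelessPart, Complex.normSq_eq_norm_sq]
        have hzq : z ^ q = Complex.exp (z.arg * Complex.I) ^ q * (‖z‖ : ℂ) ^ q := by
          rw [← mul_pow, hpolar]
        rw [g1, g2, g3, hzq]
        push_cast
        ring
      have t4 : G z 0 0 + G z 1 1 = 2 * f z := by
        rw [t1, g1, g2]; simp only [f, Complex.normSq_eq_norm_sq]; ring
      have h10 : G z 1 0 = G z 0 1 := (hsymm z hz).apply 0 1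
      have t5 := congrArg Complex.re t3
      have t6 := congrArg Complex.im t3
      simp [tracelessPart] at t5 t6
      ext i j
      fin_cases i <;> fin_cases j
      · simp; linarith
      · simp; linarith
      · simp; linarith
      · simp; linarith
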